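/- arXiv:2008.07218 — 2 statements merged into one kernel-verified Lean document; each statement's English description precedes it below -/
import Mathlib

section
/- Let p be an odd prime, let s ∈ ℤ_p, and let a ∈ ℚ_p with |a|_p > 1. Then the sequence r ↦ Σ_{k=0}^{p^r−1} (−1)^k ⟨k+a⟩^{1−s} (r ∈ ℕ) converges in ℚ_p; its limit is by definition the p-adic Hurwitz-type Euler zeta function ζ_{p,E}(s,a). -/
open Filter Topology

noncomputable def teich (p : ℕ) [Fact p.Prime] (u : ℚ_[p]) : ℚ_[p] :=
  limUnder atTop fun n : ℕ => u ^ p ^ n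

noncomputable def omegaV (p : ℕ) [Fact p.Prime] (a : ℚ_[p]) : ℚ_[p] :=
  (p : ℚ_[p]) ^ a.valuation * teich p (a * (p : ℚ_[p]) ^ (-a.valuation))

noncomputable def proj (p : ℕ) [Fact p.Prime] (a : ℚ_[p]) : ℚ_[p] :=
  a / omegaV p a

noncomputable def binom (p : ℕ) [Fact p.Prime] (s : ℚ_[p]) (n : ℕ) : ℚ_[p] :=
  (∏ j ∈ Finset.range n, (s - (j : ℚ_[p]))) / (n.factorial : ℚ_[p])

noncomputable def hpow (p : ℕ) [Fact p.Prime] (a s : ℚ_[p]) : ℚ_[p] :=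
  ∑' n : ℕ, binom p s n * (proj p a - 1) ^ n

noncomputable def zetaE (p : ℕ) [Fact p.Prime] (s a : ℚ_[p]) : ℚ_[p] :=
  limUnder atTop fun r : ℕ =>
    ∑ k ∈ Finset.range (p ^ r), (-1 : ℚ_[p]) ^ k * hpow p ((k : ℚ_[p]) + a) (1 - s)

noncomputable def coeffT (p : ℕ) [Fact p.Prime] (s a : ℚ_[p]) (n : ℕ) : ℚ_[p] :=
  (∏ j ∈ Finset.Icc 1 (n - 1), (s - 1 + (j : ℚ_[p]))) /
    ((n.factorial : ℚ_[p]) * omegaV p a ^ n)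

section Teichmuller

variable {p : ℕ} [Fact p.Prime]

theorem PadicInt.natCast_dvd_pow_sub_self (x : ℤ_[p]) : (p : ℤ_[p]) ∣ x ^ p - x := by
  rw [← Ideal.mem_span_singleton, ← PadicInt.maximalIdeal_eq_span_p, ← PadicInt.ker_toZMod,
    RingHom.mem_ker, map_sub, map_pow, ZMod.pow_card, sub_self]

theorem Padic.norm_pow_sub_pow_le_of_norm_sub_lt_one {x y : ℚ_[p]} (hx : ‖x‖ ≤ 1) (hy : ‖y‖ ≤ 1)
    (h : ‖x - y‖ < 1) (n : ℕ) : ‖x ^ p ^ n - y ^ p ^ n‖ ≤ (p : ℝ)⁻¹ ^ (n + 1) := by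
  obtain ⟨x, rfl⟩ : ∃ z : ℤ_[p], (z : ℚ_[p]) = x := ⟨⟨x, hx⟩, rfl⟩
  obtain ⟨y, rfl⟩ : ∃ z : ℤ_[p], (z : ℚ_[p]) = y := ⟨⟨y, hy⟩, rfl⟩
  have hd : (p : ℤ_[p]) ∣ x - y := (PadicInt.norm_lt_one_iff_dvd _).1 (by exact_mod_cast h)
  have hn := (PadicInt.norm_le_pow_iff_mem_span_pow (x ^ p ^ n - y ^ p ^ n) (n + 1)).2
    (Ideal.mem_span_singleton.2 (dvd_sub_pow_of_dvd_sub hd n))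
  rw [zpow_neg, zpow_natCast, ← inv_pow] at hn
  exact_mod_cast hn

theorem Padic.norm_pow_prime_sub_self_lt_one {x : ℚ_[p]} (hx : ‖x‖ ≤ 1) : ‖x ^ p - x‖ < 1 := by
  obtain ⟨x, rfl⟩ : ∃ z : ℤ_[p], (z : ℚ_[p]) = x := ⟨⟨x, hx⟩, rfl⟩
  exact_mod_cast (PadicInt.norm_lt_one_iff_dvd _).2 (PadicInt.natCast_dvd_pow_sub_self x)

theorem Padic.inv_prime_lt_one : (p : ℝ)⁻¹ < 1 :=
  inv_lt_one_of_one_lt₀ (by exact_mod_cast (Fact.out : p.Prime).one_lt)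

theorem tendsto_teich {u : ℚ_[p]} (hu : ‖u‖ ≤ 1) :
    Tendsto (fun n : ℕ => u ^ p ^ n) atTop (𝓝 (teich p u)) := by
  refine CauchySeq.tendsto_limUnder
    (cauchySeq_of_le_geometric (p : ℝ)⁻¹ 1 Padic.inv_prime_lt_one fun n => ?_)
  have hup : ‖u ^ p‖ ≤ 1 := by simpa using pow_le_one₀ (norm_nonneg u) hu
  have h := Padic.norm_pow_sub_pow_le_of_norm_sub_lt_one hup hu
    (Padic.norm_pow_prime_sub_self_lt_one hu) n
  rw [← pow_mul, ← pow_succ'] at h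
  rw [dist_comm, dist_eq_norm, one_mul]
  exact h.trans (pow_le_pow_of_le_one (by positivity) Padic.inv_prime_lt_one.le n.le_succ)

theorem norm_sub_teich_lt_one {u : ℚ_[p]} (hu : ‖u‖ ≤ 1) : ‖u - teich p u‖ < 1 := by
  have hmem : teich p u ∈ Metric.ball u 1 := by
    refine (IsUltrametricDist.isClosed_ball u 1).mem_of_tendsto (tendsto_teich hu)
      (Eventually.of_forall fun n => ?_)
    induction n with
    | zero => simp
    | succ n ih =>
      have hun : ‖u ^ p ^ n‖ ≤ 1 := by simpa using pow_le_one₀ (norm_nonneg u) hu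
      have h := Padic.norm_pow_prime_sub_self_lt_one hun
      rw [← pow_mul, ← pow_succ, ← dist_eq_norm] at h
      exact (dist_triangle_max _ (u ^ p ^ n) _).trans_lt (max_lt h ih)
  rwa [Metric.mem_ball', dist_eq_norm] at hmem

theorem teich_congr {u v : ℚ_[p]} (hu : ‖u‖ ≤ 1) (hv : ‖v‖ ≤ 1) (h : ‖u - v‖ < 1) :
    teich p u = teich p v := by
  have hz : Tendsto (fun n : ℕ => u ^ p ^ n - v ^ p ^ n) atTop (𝓝 0) :=
    squeeze_zero_norm (Padic.norm_pow_sub_pow_le_of_norm_sub_lt_one hu hv h)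
      ((tendsto_pow_atTop_nhds_zero_of_lt_one (by positivity)
        Padic.inv_prime_lt_one).comp (tendsto_add_atTop_nat 1))
  exact sub_eq_zero.1
    (tendsto_nhds_unique ((tendsto_teich hu).sub (tendsto_teich hv)) hz)

theorem Padic.norm_prime_zpow_neg_valuation {b : ℚ_[p]} (hb : b ≠ 0) :
    ‖(p : ℚ_[p]) ^ (-b.valuation)‖ = ‖b‖⁻¹ := by
  rw [Padic.norm_p_zpow, Padic.norm_eq_zpow_neg_valuation hb, neg_neg, zpow_neg, inv_inv]

theorem Padic.norm_mul_prime_zpow_neg_valuation {b : ℚ_[p]} (hb : b ≠ 0) :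
    ‖b * (p : ℚ_[p]) ^ (-b.valuation)‖ = 1 := by
  rw [norm_mul, Padic.norm_prime_zpow_neg_valuation hb, mul_inv_cancel₀ (norm_ne_zero_iff.2 hb)]

theorem norm_sub_omegaV_lt {b : ℚ_[p]} (hb : b ≠ 0) : ‖b - omegaV p b‖ < ‖b‖ := by
  have hp : (p : ℚ_[p]) ≠ 0 := by exact_mod_cast (Fact.out : p.Prime).ne_zero
  have h := norm_sub_teich_lt_one (Padic.norm_mul_prime_zpow_neg_valuation hb).le
  have e : b - omegaV p b = (p : ℚ_[p]) ^ b.valuation *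
      (b * (p : ℚ_[p]) ^ (-b.valuation) - teich p (b * (p : ℚ_[p]) ^ (-b.valuation))) := by
    rw [omegaV, mul_sub, mul_left_comm, ← zpow_add₀ hp, add_neg_cancel, zpow_zero, mul_one]
  rw [e, norm_mul, Padic.norm_p_zpow, ← Padic.norm_eq_zpow_neg_valuation hb]
  exact mul_lt_of_lt_one_right (norm_pos_iff.2 hb) h

theorem Padic.norm_eq_of_norm_sub_lt {b c : ℚ_[p]} (h : ‖b - c‖ < ‖b‖) : ‖c‖ = ‖b‖ := by
  have := Padic.add_eq_max_of_ne (q := c - b) (r := b) (by rw [norm_sub_rev]; exact h.ne)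
  rwa [sub_add_cancel, norm_sub_rev, max_eq_right h.le] at this

theorem omegaV_congr {b c : ℚ_[p]} (h : ‖b - c‖ < ‖b‖) : omegaV p b = omegaV p c := by
  have hn := Padic.norm_eq_of_norm_sub_lt h
  have hb : b ≠ 0 := norm_pos_iff.1 ((norm_nonneg _).trans_lt h)
  have hc : c ≠ 0 := norm_pos_iff.1 (hn ▸ norm_pos_iff.2 hb)
  have hv : c.valuation = b.valuation := by
    rw [Padic.norm_eq_zpow_neg_valuation hb, Padic.norm_eq_zpow_neg_valuation hc] at hn
    have hp1 : (1 : ℝ) < p := by exact_mod_cast (Fact.out : p.Prime).one_lt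
    exact neg_injective (zpow_right_injective₀ (by positivity) hp1.ne' hn)
  have ht : teich p (b * (p : ℚ_[p]) ^ (-b.valuation)) =
      teich p (c * (p : ℚ_[p]) ^ (-c.valuation)) := by
    refine teich_congr (Padic.norm_mul_prime_zpow_neg_valuation hb).le
      (Padic.norm_mul_prime_zpow_neg_valuation hc).le ?_
    rw [hv, ← sub_mul, norm_mul, Padic.norm_prime_zpow_neg_valuation hb, ← div_eq_mul_inv]
    exact (div_lt_one (norm_pos_iff.2 hb)).2 h
  rw [omegaV, omegaV, ht, hv]

theorem norm_proj_sub_one_lt_one {b : ℚ_[p]} (hb : b ≠ 0) : ‖proj p b - 1‖ < 1 := by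
  have h := norm_sub_omegaV_lt hb
  have hn := Padic.norm_eq_of_norm_sub_lt h
  have h0 : omegaV p b ≠ 0 := norm_pos_iff.1 (hn ▸ norm_pos_iff.2 hb)
  rw [proj, div_sub_one h0, norm_div, hn]
  exact (div_lt_one (norm_pos_iff.2 hb)).2 h

end Teichmuller

section BinomialSeries

variable {p : ℕ} [Fact p.Prime]

theorem norm_binom_le_one {t : ℚ_[p]} (ht : ‖t‖ ≤ 1) (n : ℕ) : ‖binom p t n‖ ≤ 1 := by
  obtain ⟨t, rfl⟩ : ∃ z : ℤ_[p], (z : ℚ_[p]) = t := ⟨⟨t, ht⟩, rfl⟩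
  have h : ∏ j ∈ Finset.range n, (t - (j : ℤ_[p])) = (n.factorial : ℤ_[p]) * Ring.choose t n := by
    rw [← nsmul_eq_mul, ← Ring.descPochhammer_eq_factorial_smul_choose,
      ← descPochhammer_eval_eq_prod_range, ← Polynomial.aeval_eq_smeval, Polynomial.aeval_def,
      Polynomial.eval₂_eq_eval_map, descPochhammer_map]
  have h' : binom p t n = (Ring.choose t n : ℤ_[p]) := by
    rw [binom, div_eq_iff (by exact_mod_cast n.factorial_ne_zero), mul_comm]
    have hc := congrArg PadicInt.Coe.ringHom h
    simp only [map_prod, map_sub, map_mul, map_natCast] at hc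
    exact hc
  rw [h']
  exact PadicInt.norm_le_one _

theorem summable_binom_mul_pow {t x : ℚ_[p]} (ht : ‖t‖ ≤ 1) (hx : ‖x‖ < 1) :
    Summable fun n : ℕ => binom p t n * x ^ n :=
  Summable.of_norm_bounded (summable_geometric_of_lt_one (norm_nonneg x) hx) fun n => by
    rw [norm_mul, norm_pow]
    exact mul_le_of_le_one_left (by positivity) (norm_binom_le_one ht n)

theorem Padic.norm_pow_sub_pow_le {x y : ℚ_[p]} (hx : ‖x‖ ≤ 1) (hy : ‖y‖ ≤ 1) (n : ℕ) :
    ‖x ^ n - y ^ n‖ ≤ ‖x - y‖ := by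
  rw [← geom_sum₂_mul, norm_mul]
  refine mul_le_of_le_one_left (norm_nonneg _)
    (IsUltrametricDist.norm_sum_le_of_forall_le_of_nonneg zero_le_one fun i _ => ?_)
  rw [norm_mul, norm_pow, norm_pow]
  exact mul_le_one₀ (pow_le_one₀ (norm_nonneg _) hx) (by positivity)
    (pow_le_one₀ (norm_nonneg _) hy)

theorem norm_tsum_binom_sub_tsum_binom_le {t x y : ℚ_[p]} (ht : ‖t‖ ≤ 1) (hx : ‖x‖ < 1)
    (hy : ‖y‖ < 1) :
    ‖∑' n : ℕ, binom p t n * x ^ n - ∑' n : ℕ, binom p t n * y ^ n‖ ≤ ‖x - y‖ := by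
  have h := ((summable_binom_mul_pow ht hx).hasSum.sub (summable_binom_mul_pow ht hy).hasSum)
  refine le_of_tendsto (Tendsto.norm h) (Eventually.of_forall fun S =>
    IsUltrametricDist.norm_sum_le_of_forall_le_of_nonneg (norm_nonneg _) fun n _ => ?_)
  rw [← mul_sub, norm_mul]
  exact (mul_le_of_le_one_left (norm_nonneg _) (norm_binom_le_one ht n)).trans
    (Padic.norm_pow_sub_pow_le hx.le hy.le n)

theorem norm_hpow_sub_hpow_le {t b c : ℚ_[p]} (ht : ‖t‖ ≤ 1) (hb : 1 ≤ ‖b‖)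
    (h : ‖b - c‖ < ‖b‖) : ‖hpow p b t - hpow p c t‖ ≤ ‖b - c‖ := by
  have hb0 : b ≠ 0 := norm_pos_iff.1 (zero_lt_one.trans_le hb)
  have hc0 : c ≠ 0 := norm_pos_iff.1 (Padic.norm_eq_of_norm_sub_lt h ▸ norm_pos_iff.2 hb0)
  refine (norm_tsum_binom_sub_tsum_binom_le ht (norm_proj_sub_one_lt_one hb0)
    (norm_proj_sub_one_lt_one hc0)).trans ?_
  rw [sub_sub_sub_cancel_right, proj, proj, ← omegaV_congr h, ← sub_div, norm_div,
    Padic.norm_eq_of_norm_sub_lt (norm_sub_omegaV_lt hb0)]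
  exact div_le_self (norm_nonneg _) hb

end BinomialSeries

section AlternatingSums

theorem Finset.sum_range_mul_eq_sum_sum {M : Type*} [AddCommMonoid M] (f : ℕ → M) (m n : ℕ) :
    ∑ k ∈ range (m * n), f k = ∑ j ∈ range n, ∑ k ∈ range m, f (m * j + k) := by
  induction n with
  | zero => simp
  | succ n ih => rw [mul_add_one, Finset.sum_range_add, ih, Finset.sum_range_succ]

theorem Odd.sum_range_neg_one_pow {R : Type*} [Ring R] {n : ℕ} (hn : Odd n) :
    ∑ j ∈ Finset.range n, (-1 : R) ^ j = 1 := by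
  rw [neg_one_geom_sum, if_neg (Nat.not_even_iff_odd.2 hn)]

theorem cauchySeq_alternating_sum {p : ℕ} [Fact p.Prime] (hodd : p ≠ 2) {f : ℕ → ℚ_[p]}
    (hf : ∀ k l : ℕ, ‖f k - f l‖ ≤ ‖(k : ℚ_[p]) - l‖) :
    CauchySeq fun r : ℕ => ∑ k ∈ Finset.range (p ^ r), (-1 : ℚ_[p]) ^ k * f k := by
  have hpo : Odd p := (Fact.out : p.Prime).odd_of_ne_two hodd
  refine cauchySeq_of_le_geometric (p : ℝ)⁻¹ 1 Padic.inv_prime_lt_one fun r => ?_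
  have e : ∑ k ∈ Finset.range (p ^ (r + 1)), (-1 : ℚ_[p]) ^ k * f k -
      ∑ k ∈ Finset.range (p ^ r), (-1 : ℚ_[p]) ^ k * f k =
      ∑ j ∈ Finset.range p, ∑ k ∈ Finset.range (p ^ r),
        (-1 : ℚ_[p]) ^ j * (-1) ^ k * (f (p ^ r * j + k) - f k) := by
    have e₁ : ∑ k ∈ Finset.range (p ^ r), (-1 : ℚ_[p]) ^ k * f k =
        ∑ j ∈ Finset.range p, ∑ k ∈ Finset.range (p ^ r),
          (-1 : ℚ_[p]) ^ j * (-1) ^ k * f k := by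
      simp_rw [mul_assoc, ← Finset.mul_sum]
      rw [← Finset.sum_mul, hpo.sum_range_neg_one_pow, one_mul]
    rw [e₁, pow_succ, Finset.sum_range_mul_eq_sum_sum, ← Finset.sum_sub_distrib]
    refine Finset.sum_congr rfl fun j _ => ?_
    rw [← Finset.sum_sub_distrib]
    refine Finset.sum_congr rfl fun k _ => ?_
    rw [pow_add, pow_mul, hpo.pow.neg_one_pow, mul_sub]
  rw [dist_comm, dist_eq_norm, e, one_mul]
  refine IsUltrametricDist.norm_sum_le_of_forall_le_of_nonneg (by positivity) fun j _ =>
    IsUltrametricDist.norm_sum_le_of_forall_le_of_nonneg (by positivity) fun k _ => ?_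
  have hj : ‖(j : ℚ_[p])‖ ≤ 1 := by exact_mod_cast Padic.norm_int_le_one (p := p) j
  refine (le_of_eq (by simp)).trans ((hf (p ^ r * j + k) k).trans ?_)
  rw [Nat.cast_add, add_sub_cancel_right, Nat.cast_mul, Nat.cast_pow, norm_mul, norm_pow,
    Padic.norm_p]
  exact mul_le_of_le_one_right (by positivity) hj

end AlternatingSums

/-- For an odd prime `p`, `s ∈ ℤ_p` and `a ∈ ℚ_p` with `|a|_p > 1`, the sequence
`r ↦ ∑_{k=0}^{p^r - 1} (-1)^k ⟨k + a⟩^{1-s}` converges in `ℚ_p`, with limit `ζ_{p,E}(s, a)`. -/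
theorem padic_hurwitz_euler_zeta_defining_limit
    (p : ℕ) [Fact p.Prime] (hodd : p ≠ 2)
    (s : ℚ_[p]) (hs : ‖s‖ ≤ 1)
    (a : ℚ_[p]) (ha : 1 < ‖a‖) :
    Tendsto
      (fun r : ℕ =>
        ∑ k ∈ Finset.range (p ^ r), (-1 : ℚ_[p]) ^ k * hpow p ((k : ℚ_[p]) + a) (1 - s))
      atTop (𝓝 (zetaE p s a)) := by
  have hnat (n : ℤ) : ‖(n : ℚ_[p])‖ ≤ 1 := Padic.norm_int_le_one n
  have ht : ‖1 - s‖ ≤ 1 :=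
    (sub_eq_add_neg (1 : ℚ_[p]) s ▸ Padic.nonarchimedean 1 (-s)).trans
      (max_le norm_one.le ((norm_neg s).trans_le hs))
  refine CauchySeq.tendsto_limUnder (cauchySeq_alternating_sum hodd fun k l => ?_)
  have hk : ‖(k : ℚ_[p])‖ ≤ 1 := by exact_mod_cast hnat k
  have hkl : ‖(k : ℚ_[p]) - l‖ ≤ 1 := by exact_mod_cast hnat (k - l)
  have hka : ‖(k : ℚ_[p]) + a‖ = ‖a‖ := by
    rw [Padic.add_eq_max_of_ne (hk.trans_lt ha).ne, max_eq_right (hk.trans ha.le)]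
  have e : (k : ℚ_[p]) + a - (l + a) = k - l := add_sub_add_right_eq_sub _ _ _
  rw [← e] at hkl ⊢
  exact norm_hpow_sub_hpow_le ht (hka ▸ ha.le) (hka ▸ hkl.trans_lt ha)
end

section
/- Let p be an odd prime, let a ∈ ℚ_p with |a|_p > 1, and let m ≥ 1 be an integer. Then ζ_{p,E}(1−m, a) = ω_v(a)^{−m} · E_m(a), where E_m ∈ ℚ[X] is the m-th Euler polynomial, i.e. the unique polynomial satisfying E_m(X+1) + E_m(X) = 2X^m. -/
open Filter Topology

theorem hpow_natCast (p : ℕ) [Fact p.Prime] (a : ℚ_[p]) (m : ℕ) :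
    hpow p a (m : ℚ_[p]) = proj p a ^ m := by
  have hb (n : ℕ) : binom p (m : ℚ_[p]) n = (m.choose n : ℚ_[p]) := by
    have h : ∏ j ∈ Finset.range n, ((m : ℚ_[p]) - (j : ℚ_[p])) = (m.descFactorial n : ℚ_[p]) := by
      rw [← descPochhammer_eval_eq_descFactorial, descPochhammer_eval_eq_prod_range]
    rw [binom, h, Nat.descFactorial_eq_factorial_mul_choose, Nat.cast_mul,
      mul_div_cancel_left₀ _ (Nat.cast_ne_zero.2 n.factorial_ne_zero)]
  have hz : ∀ n ∉ Finset.range (m + 1),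
      binom p (m : ℚ_[p]) n * (proj p a - 1) ^ n = 0 := by
    intro n hn
    rw [hb, Nat.choose_eq_zero_of_lt (by simpa using hn)]
    simp
  rw [hpow, tsum_eq_sum hz]
  conv_rhs => rw [← sub_add_cancel (proj p a) 1, add_pow]
  refine Finset.sum_congr rfl fun n _ => ?_
  rw [hb]
  ring

theorem teich_congr_s1 (p : ℕ) [Fact p.Prime] (x y : ℤ_[p]) (h : (p : ℤ_[p]) ∣ x - y) :
    teich p (x : ℚ_[p]) = teich p (y : ℚ_[p]) := by
  have hp : 1 < (p : ℝ) := by exact_mod_cast (Fact.out : p.Prime).one_lt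
  have h0 : Tendsto (fun n : ℕ => (x : ℚ_[p]) ^ p ^ n - (y : ℚ_[p]) ^ p ^ n) atTop (𝓝 0) := by
    refine squeeze_zero_norm (a := fun n : ℕ => ((p : ℝ)⁻¹) ^ n) (fun n => ?_)
      (tendsto_pow_atTop_nhds_zero_of_lt_one (by positivity) (inv_lt_one_of_one_lt₀ hp))
    have hd : (p : ℤ_[p]) ^ n ∣ x ^ p ^ n - y ^ p ^ n :=
      (pow_dvd_pow _ n.le_succ).trans (dvd_sub_pow_of_dvd_sub h n)
    have hn := (PadicInt.norm_le_pow_iff_mem_span_pow _ n).2 (Ideal.mem_span_singleton.2 hd)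
    rw [PadicInt.norm_def] at hn
    simpa using hn
  have key : (fun l : ℚ_[p] => Tendsto (fun n : ℕ => (x : ℚ_[p]) ^ p ^ n) atTop (𝓝 l)) =
      fun l => Tendsto (fun n : ℕ => (y : ℚ_[p]) ^ p ^ n) atTop (𝓝 l) := by
    ext l
    constructor
    · intro hx
      simpa using hx.sub h0
    · intro hy
      simpa using hy.add h0
  simp only [teich, limUnder, lim]
  exact congrArg (fun P => Classical.epsilon P) key

theorem omegaV_natCast_add (p : ℕ) [Fact p.Prime] (a : ℚ_[p]) (ha : 1 < ‖a‖) (k : ℕ) :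
    omegaV p ((k : ℚ_[p]) + a) = omegaV p a := by
  have hp : 1 < (p : ℝ) := by exact_mod_cast (Fact.out : p.Prime).one_lt
  have hk : ‖(k : ℚ_[p])‖ ≤ 1 := by simpa using (k : ℤ_[p]).2
  have hnorm : ‖(k : ℚ_[p]) + a‖ = ‖a‖ := by
    rw [Padic.add_eq_max_of_ne (hk.trans_lt ha).ne, max_eq_right (hk.trans ha.le)]
  have ha0 : a ≠ 0 := norm_pos_iff.1 (one_pos.trans ha)
  have hka0 : (k : ℚ_[p]) + a ≠ 0 := norm_pos_iff.1 (by rw [hnorm]; exact one_pos.trans ha)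
  have hval : ((k : ℚ_[p]) + a).valuation = a.valuation := by
    have h := hnorm
    rw [Padic.norm_eq_zpow_neg_valuation hka0, Padic.norm_eq_zpow_neg_valuation ha0] at h
    simpa using zpow_right_injective₀ (one_pos.trans hp) hp.ne' h
  have hneg : a.valuation < 0 := by
    rw [Padic.norm_eq_zpow_neg_valuation ha0, one_lt_zpow_iff_right₀ hp] at ha
    omega
  obtain ⟨j, hj⟩ : ∃ j : ℕ, -a.valuation = (j : ℤ) + 1 :=
    ⟨(-a.valuation - 1).toNat, by omega⟩
  have hu : ‖a * (p : ℚ_[p]) ^ (-a.valuation)‖ ≤ 1 := by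
    rw [norm_mul, Padic.norm_eq_zpow_neg_valuation ha0, Padic.norm_p_zpow, ← zpow_add₀ (by positivity)]
    simp
  have hpow : (p : ℚ_[p]) ^ (-a.valuation) = (p : ℚ_[p]) ^ (j + 1) := by
    rw [hj]
    exact_mod_cast zpow_natCast (p : ℚ_[p]) (j + 1)
  set y : ℤ_[p] := ⟨a * (p : ℚ_[p]) ^ (-a.valuation), hu⟩
  have hx : ((k : ℚ_[p]) + a) * (p : ℚ_[p]) ^ (-a.valuation) =
      ((y + (p : ℤ_[p]) * ((k : ℤ_[p]) * (p : ℤ_[p]) ^ j) : ℤ_[p]) : ℚ_[p]) := by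
    have hyc : (y : ℚ_[p]) = a * (p : ℚ_[p]) ^ (-a.valuation) := rfl
    push_cast
    rw [hyc, add_mul, hpow]
    ring
  have ht : teich p (((k : ℚ_[p]) + a) * (p : ℚ_[p]) ^ (-a.valuation)) =
      teich p (a * (p : ℚ_[p]) ^ (-a.valuation)) := by
    rw [hx]
    exact teich_congr_s1 p _ y (by simp)
  rw [omegaV, omegaV, hval, ht]

theorem two_mul_alternating_sum_add_pow {K : Type*} [Field K] [CharZero K] {m : ℕ}
    {E : Polynomial ℚ} (hE : E.comp (Polynomial.X + 1) + E = 2 * Polynomial.X ^ m) (a : K) (N : ℕ) :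
    2 * ∑ k ∈ Finset.range N, (-1 : K) ^ k * ((k : K) + a) ^ m =
      (E.map (Rat.castHom K)).eval a - (-1) ^ N * (E.map (Rat.castHom K)).eval ((N : K) + a) := by
  have hev (x : K) : (E.map (Rat.castHom K)).eval (x + 1) + (E.map (Rat.castHom K)).eval x =
      2 * x ^ m := by
    have h := congrArg (fun P : Polynomial ℚ => (P.map (Rat.castHom K)).eval x) hE
    simpa [Polynomial.map_comp, Polynomial.eval_comp] using h
  induction N with
  | zero => simp
  | succ N ih =>
    rw [Finset.sum_range_succ, mul_add, ih, mul_left_comm, ← hev]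
    push_cast
    rw [add_right_comm (N : K) 1 a]
    ring

/-- For an odd prime `p`, `a ∈ ℚ_p` with `|a|_p > 1` and an integer `m ≥ 1`,
`ζ_{p,E}(1 - m, a) = ω_v(a)^{-m} · E_m(a)`, where `E_m` is the m-th Euler polynomial,
i.e. the unique rational polynomial with `E_m(X+1) + E_m(X) = 2 X^m`. -/
theorem padic_hurwitz_euler_zeta_special_values
    (p : ℕ) [Fact p.Prime] (hodd : p ≠ 2)
    (a : ℚ_[p]) (ha : 1 < ‖a‖)
    (m : ℕ) (hm : 1 ≤ m)
    (E : Polynomial ℚ)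
    (hE : E.comp (Polynomial.X + 1) + E = 2 * Polynomial.X ^ m) :
    zetaE p (1 - (m : ℚ_[p])) a =
      omegaV p a ^ (-(m : ℤ)) * Polynomial.eval a (E.map (Rat.castHom ℚ_[p])) := by
  have hp : p.Prime := Fact.out
  have hlim : Tendsto (fun r : ℕ => ((p ^ r : ℕ) : ℚ_[p])) atTop (𝓝 0) := by
    simpa using tendsto_pow_atTop_nhds_zero_of_norm_lt_one (Padic.norm_p_lt_one (p := p))
  have hterm (r : ℕ) : ∑ k ∈ Finset.range (p ^ r),
      (-1 : ℚ_[p]) ^ k * hpow p ((k : ℚ_[p]) + a) (1 - (1 - (m : ℚ_[p]))) =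
      omegaV p a ^ (-(m : ℤ)) * ((Polynomial.eval a (E.map (Rat.castHom ℚ_[p])) +
        Polynomial.eval (((p ^ r : ℕ) : ℚ_[p]) + a) (E.map (Rat.castHom ℚ_[p]))) / 2) := by
    have h := two_mul_alternating_sum_add_pow hE a (p ^ r)
    rw [((hp.odd_of_ne_two hodd).pow).neg_one_pow, neg_one_mul, sub_neg_eq_add] at h
    rw [← h, mul_div_cancel_left₀ _ two_ne_zero, Finset.mul_sum]
    refine Finset.sum_congr rfl fun k _ => ?_
    rw [sub_sub_cancel, hpow_natCast, proj, omegaV_natCast_add p a ha, div_pow, zpow_neg,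
      zpow_natCast]
    ring
  refine Tendsto.limUnder_eq ?_
  simp only [hterm]
  have hc : Tendsto (fun r : ℕ =>
      Polynomial.eval (((p ^ r : ℕ) : ℚ_[p]) + a) (E.map (Rat.castHom ℚ_[p]))) atTop
      (𝓝 (Polynomial.eval a (E.map (Rat.castHom ℚ_[p])))) := by
    refine ((E.map (Rat.castHom ℚ_[p])).continuous.tendsto a).comp ?_
    simpa using hlim.add_const a
  have hlimit := ((hc.const_add (Polynomial.eval a (E.map (Rat.castHom ℚ_[p])))).div_const 2).const_mul
    (omegaV p a ^ (-(m : ℤ)))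
  rwa [add_self_div_two] at hlimit
end
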